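/- Let q = 2^k be a power of 2 and let m ≥ 4 be even. Then the symplectic group Sp_{2m}(F_q) (whose center is trivial in characteristic 2, so Sp_{2m}(F_q) = PSp_{2m}(F_q)) contains a proper subgroup H with exp(H) = exp(Sp_{2m}(F_q)). -/

import Mathlib

namespace SymplecticEvenChar

open Matrix Polynomial

section Forms

variable {ι F : Type*} [Fintype ι] [DecidableEq ι] [Field F]

/-- The standard symplectic bilinear form. -/
noncomputable def symplecticForm (ι F : Type*) [Fintype ι] [DecidableEq ι] [Field F] :
    LinearMap.BilinForm F (ι ⊕ ι → F) :=
  Matrix.toBilin' (J ι F)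

local notation "ω" => symplecticForm ι F

/-- The split quadratic form `∑ xᵢ yᵢ`. -/
def splitForm (x : ι ⊕ ι → F) : F := ∑ i, x (Sum.inl i) * x (Sum.inr i)

/-- The quadratic form `x ↦ splitForm x + ω v x ^ 2`; in characteristic two these are all the
quadratic forms whose polar form is the standard symplectic form. -/
noncomputable def twistedForm (v x : ι ⊕ ι → F) : F :=
  splitForm x + symplecticForm ι F v x ^ 2

theorem mem_iff_symplecticForm {M : Matrix (ι ⊕ ι) (ι ⊕ ι) F} :
    M ∈ symplecticGroup ι F ↔ ∀ x y, ω (M *ᵥ x) (M *ᵥ y) = ω x y := by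
  rw [SymplecticGroup.mem_iff']
  have key : ∀ x y, ω (M *ᵥ x) (M *ᵥ y) = Matrix.toBilin' (Mᵀ * J ι F * M) x y := by
    intro x y
    simp only [symplecticForm, Matrix.toBilin'_apply', ← Matrix.mulVec_mulVec]
    rw [Matrix.dotProduct_mulVec (M *ᵥ x), Matrix.dotProduct_mulVec x Mᵀ,
      Matrix.vecMul_transpose, ← Matrix.dotProduct_mulVec]
  constructor
  · intro h x y
    rw [key, h, symplecticForm]
  · intro h
    apply Matrix.toBilin'.injective
    refine LinearMap.ext fun x => LinearMap.ext fun y => ?_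
    rw [← key, h, symplecticForm]

theorem symplecticForm_map (g : symplecticGroup ι F) (x y : ι ⊕ ι → F) :
    ω (g.1 *ᵥ x) (g.1 *ᵥ y) = ω x y :=
  mem_iff_symplecticForm.1 g.2 x y

theorem mulVec_inv_mulVec (g : symplecticGroup ι F) (x : ι ⊕ ι → F) :
    g.1 *ᵥ (g⁻¹).1 *ᵥ x = x := by
  rw [Matrix.mulVec_mulVec, ← Submonoid.coe_mul, mul_inv_cancel, Submonoid.coe_one,
    Matrix.one_mulVec]

theorem inv_mulVec_mulVec (g : symplecticGroup ι F) (x : ι ⊕ ι → F) :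
    (g⁻¹).1 *ᵥ g.1 *ᵥ x = x := by
  rw [Matrix.mulVec_mulVec, ← Submonoid.coe_mul, inv_mul_cancel, Submonoid.coe_one,
    Matrix.one_mulVec]

theorem nondegenerate_symplecticForm : (ω).Nondegenerate := by
  rw [symplecticForm]
  exact LinearMap.BilinForm.nondegenerate_toBilin'_of_det_ne_zero' _ (isUnit_det_J ι F).ne_zero

theorem splitForm_smul {ι F : Type*} [Fintype ι] [Field F] (c : F) (x : ι ⊕ ι → F) :
    splitForm (c • x) = c ^ 2 * splitForm x := by
  simp only [splitForm, Pi.smul_apply, smul_eq_mul, Finset.mul_sum]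
  exact Finset.sum_congr rfl fun i _ => by ring

theorem twistedForm_smul (v x : ι ⊕ ι → F) (c : F) :
    twistedForm v (c • x) = c ^ 2 * twistedForm v x := by
  simp only [twistedForm, splitForm_smul, map_smul, smul_eq_mul]
  ring

variable [CharP F 2]

theorem symplecticForm_apply (x y : ι ⊕ ι → F) :
    ω x y = ∑ i, (x (Sum.inl i) * y (Sum.inr i) + x (Sum.inr i) * y (Sum.inl i)) := by
  simp [symplecticForm, Matrix.toBilin'_apply', J, Matrix.fromBlocks_mulVec, dotProduct,
    CharTwo.neg_eq, Matrix.neg_mulVec, Finset.sum_add_distrib]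

theorem symplecticForm_self (x : ι ⊕ ι → F) : ω x x = 0 := by
  rw [symplecticForm_apply]
  exact Finset.sum_eq_zero fun i _ => by rw [mul_comm, CharTwo.add_self_eq_zero]

theorem symplecticForm_comm (x y : ι ⊕ ι → F) : ω x y = ω y x := by
  simp only [symplecticForm_apply]
  exact Finset.sum_congr rfl fun i _ => by ring

theorem splitForm_add (x y : ι ⊕ ι → F) :
    splitForm (x + y) = splitForm x + splitForm y + ω x y := by
  simp only [splitForm, symplecticForm_apply, Pi.add_apply, ← Finset.sum_add_distrib]
  exact Finset.sum_congr rfl fun i _ => by ring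

theorem twistedForm_add_left (v w x : ι ⊕ ι → F) :
    twistedForm (v + w) x = twistedForm v x + ω w x ^ 2 := by
  simp only [twistedForm, map_add, LinearMap.add_apply, CharTwo.add_sq]
  ring

theorem twistedForm_add (v x y : ι ⊕ ι → F) :
    twistedForm v (x + y) = twistedForm v x + twistedForm v y + ω x y := by
  simp only [twistedForm, splitForm_add, map_add, CharTwo.add_sq]
  ring

theorem twistedForm_injective :
    Function.Injective (twistedForm : (ι ⊕ ι → F) → (ι ⊕ ι → F) → F) := by
  intro v w h
  rw [← sub_eq_zero]
  refine nondegenerate_symplecticForm.1 _ fun x => ?_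
  have := congrFun h x
  simp only [twistedForm, add_right_inj] at this
  rw [map_sub, LinearMap.sub_apply, CharTwo.sub_eq_add]
  rw [← sq_eq_zero_iff, CharTwo.add_sq, this, CharTwo.add_self_eq_zero]

/-- The symplectic transvection `x ↦ x + c ω(u, x) u`. -/
theorem exists_transvection (c : F) (u : ι ⊕ ι → F) :
    ∃ g : symplecticGroup ι F, ∀ x, g.1 *ᵥ x = x + (c * ω u x) • u := by
  let T : (ι ⊕ ι → F) →ₗ[F] (ι ⊕ ι → F) :=
    LinearMap.id + c • (LinearMap.toSpanSingleton F _ u).comp (ω u)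
  have hT : ∀ x, LinearMap.toMatrix' T *ᵥ x = x + (c * ω u x) • u := by
    intro x
    rw [LinearMap.toMatrix'_mulVec]
    simp [T, LinearMap.toSpanSingleton_apply, smul_smul]
  refine ⟨⟨LinearMap.toMatrix' T, mem_iff_symplecticForm.2 fun x y => ?_⟩, hT⟩
  simp only [hT, map_add, LinearMap.add_apply, map_smul, LinearMap.smul_apply, smul_eq_mul,
    symplecticForm_self, symplecticForm_comm x u]
  linear_combination (c * ω u x * ω u y) * CharTwo.two_eq_zero (R := F)

/-- Two of the forms whose parameters agree modulo `{d ^ 2 + d}` are related by a transvection. -/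
theorem exists_twistedForm_eq {v w : ι ⊕ ι → F}
    (h : ∃ d, d ^ 2 + d = splitForm v + splitForm w) :
    ∃ g : symplecticGroup ι F, ∀ x, twistedForm v (g.1 *ᵥ x) = twistedForm w x := by
  have htwo : (2 : F) = 0 := CharTwo.two_eq_zero
  obtain ⟨d, hd⟩ := h
  set b := ω v w with hb
  obtain ⟨d, hd, hd0⟩ : ∃ d, d ^ 2 + d = splitForm v + splitForm w + b + b ^ 2 ∧ d ≠ 0 := by
    by_cases h0 : d + b = 0
    · refine ⟨1, ?_, one_ne_zero⟩
      have : d = b := by rw [← CharTwo.neg_eq b]; exact eq_neg_of_add_eq_zero_left h0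
      rw [← hd, this]
      linear_combination (1 - b - b ^ 2) * htwo
    · refine ⟨d + b, ?_, h0⟩
      rw [← hd]
      linear_combination (b * d) * htwo
  obtain ⟨g, hg⟩ := exists_transvection d⁻¹ (v + w)
  refine ⟨g, fun x => ?_⟩
  have hw : twistedForm w x = twistedForm v x + ω (v + w) x ^ 2 := by
    simp only [twistedForm, map_add, LinearMap.add_apply]
    linear_combination (-(ω v x ^ 2) - ω v x * ω w x) * htwo
  have hu : twistedForm v (v + w) = d ^ 2 + d := by
    rw [hd, twistedForm, splitForm_add, map_add, symplecticForm_self, zero_add]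
  rw [hg, hw, twistedForm_add, twistedForm_smul, hu, map_smul, smul_eq_mul,
    symplecticForm_comm x]
  field_simp
  linear_combination (ω (v + w) x ^ 2) * htwo

end Forms

section ArtinSchreier

variable (F : Type*) [Field F] [CharP F 2]

/-- The additive map `d ↦ d ^ 2 + d`. -/
def artinSchreier : F →+ F where
  toFun d := d ^ 2 + d
  map_zero' := by simp
  map_add' a b := by rw [CharTwo.add_sq]; ring

theorem index_range_artinSchreier [Finite F] : (artinSchreier F).range.index = 2 := by
  have hker : ((artinSchreier F).ker : Set F) = {0, 1} := by
    ext d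
    simp only [SetLike.mem_coe, AddMonoidHom.mem_ker, Set.mem_insert_iff, Set.mem_singleton_iff]
    change d ^ 2 + d = 0 ↔ _
    rw [show d ^ 2 + d = d * (d - 1) by
      linear_combination d * CharTwo.two_eq_zero (R := F), mul_eq_zero, sub_eq_zero]
  have h2 : Nat.card (artinSchreier F).ker = 2 := by
    change Nat.card ((artinSchreier F).ker : Set F) = 2
    rw [hker, Nat.card_coe_set_eq, Set.ncard_pair zero_ne_one]
  have h1 := AddSubgroup.card_mul_index (artinSchreier F).ker
  have h3 := AddSubgroup.card_mul_index (artinSchreier F).range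
  rw [AddSubgroup.index_ker, ← h3, mul_comm, h2] at h1
  exact (Nat.eq_of_mul_eq_mul_left Nat.card_pos h1).symm

end ArtinSchreier

section Conjugacy

variable {ι F : Type*} [Fintype ι] [DecidableEq ι] [Field F]

local notation "ω" => symplecticForm ι F

/-- The isometry group of the form with parameter `v`. -/
def formStabilizer (v : ι ⊕ ι → F) : Subgroup (symplecticGroup ι F) where
  carrier := {g | ∀ x, twistedForm v (g.1 *ᵥ x) = twistedForm v x}
  one_mem' x := by simp
  mul_mem' {a b} ha hb x := by
    rw [Submonoid.coe_mul, ← Matrix.mulVec_mulVec, ha, hb]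
  inv_mem' {a} ha x := by
    rw [← ha, mulVec_inv_mulVec]

theorem mem_formStabilizer {v : ι ⊕ ι → F} {g : symplecticGroup ι F} :
    g ∈ formStabilizer v ↔ ∀ x, twistedForm v (g.1 *ᵥ x) = twistedForm v x :=
  Iff.rfl

theorem exists_conj_mem_of_twistedForm_eq {v w : ι ⊕ ι → F} {g k : symplecticGroup ι F}
    (hg : g ∈ formStabilizer w) (hk : ∀ x, twistedForm v (k.1 *ᵥ x) = twistedForm w x) :
    k * g * k⁻¹ ∈ formStabilizer v := by
  intro x
  rw [Submonoid.coe_mul, Submonoid.coe_mul, ← Matrix.mulVec_mulVec, ← Matrix.mulVec_mulVec,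
    hk, hg, ← hk, mulVec_inv_mulVec]

theorem exists_symplecticForm_eq (l : (ι ⊕ ι → F) →ₗ[F] F) : ∃ w, ∀ x, ω w x = l x := by
  obtain ⟨w, hw⟩ := (LinearMap.BilinForm.toDual ω nondegenerate_symplecticForm).surjective l
  exact ⟨w, fun x => by rw [← hw]; rfl⟩

/-- Twice the number of vectors whose value under the split form avoids a given additive subgroup
of index two. -/
theorem two_mul_card_splitForm_notMem [Finite F] {P : AddSubgroup F} (hP : P.index = 2) :
    2 * Nat.card {v : ι ⊕ ι → F | splitForm v ∉ P} =
      (Nat.card F ^ Fintype.card ι - 1) * Nat.card F ^ Fintype.card ι := by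
  classical
  have := Fintype.ofFinite F
  have hfib : ∀ x : ι → F,
      2 * Nat.card {y : ι → F // x ⬝ᵥ y ∉ P} =
        if x = 0 then 0 else Nat.card F ^ Fintype.card ι := by
    intro x
    split_ifs with hx
    · simp [hx, P.zero_mem]
    · let l : (ι → F) →+ F :=
        { toFun := fun y => x ⬝ᵥ y
          map_zero' := dotProduct_zero x
          map_add' := dotProduct_add x }
      have hl : Function.Surjective l := by
        obtain ⟨i, hi⟩ := Function.ne_iff.1 hx
        intro c
        refine ⟨Pi.single i ((x i)⁻¹ * c), ?_⟩
        change x ⬝ᵥ _ = c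
        rw [dotProduct_single, mul_inv_cancel_left₀ hi]
      have hidx := AddSubgroup.index_comap_of_surjective P hl
      rw [hP] at hidx
      have hc := AddSubgroup.card_mul_index (P.comap l)
      rw [hidx] at hc
      have hcompl : Nat.card {y : ι → F // x ⬝ᵥ y ∉ P} + Nat.card (P.comap l) =
          Nat.card (ι → F) := by
        have := Nat.card_congr (Equiv.sumCompl fun y : ι → F => x ⬝ᵥ y ∈ P)
        rw [Nat.card_sum] at this
        rw [add_comm, ← this]
        rfl
      have hV : Nat.card (ι → F) = Nat.card F ^ Fintype.card ι := by
        rw [Nat.card_fun, Nat.card_eq_fintype_card (α := ι)]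
      omega
  let e : {v : ι ⊕ ι → F | splitForm v ∉ P} ≃ Σ x : ι → F, {y : ι → F // x ⬝ᵥ y ∉ P} :=
    ((Equiv.sumArrowEquivProdArrow ι ι F).subtypeEquiv (p := fun v => splitForm v ∉ P)
      (q := fun z : (ι → F) × (ι → F) => z.1 ⬝ᵥ z.2 ∉ P) fun v => Iff.rfl).trans
      (Equiv.subtypeProdEquivSigmaSubtype fun x y : ι → F => x ⬝ᵥ y ∉ P)
  rw [Nat.card_congr e, Nat.card_sigma, Finset.mul_sum, Finset.sum_congr rfl fun x _ => hfib x,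
    Finset.sum_ite, Finset.sum_const_zero, zero_add, Finset.sum_const, smul_eq_mul]
  congr 1
  rw [Finset.filter_ne' Finset.univ, Finset.card_erase_of_mem (Finset.mem_univ _),
    Finset.card_univ, Fintype.card_fun, Nat.card_eq_fintype_card]

variable [CharP F 2]

theorem formStabilizer_ne_top {v w : ι ⊕ ι → F} (hne : v ≠ w)
    (h : splitForm v = splitForm w) : formStabilizer v ≠ ⊤ := by
  intro htop
  obtain ⟨g, hg⟩ := exists_twistedForm_eq (v := v) (w := w)
    ⟨0, by rw [h, CharTwo.add_self_eq_zero]; simp⟩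
  have hgv : g ∈ formStabilizer v := htop ▸ Subgroup.mem_top g
  exact hne (twistedForm_injective (funext fun x => by rw [← hg, hgv x]))

variable [Finite F]

theorem exists_twistedForm_comp (g : symplecticGroup ι F) (v : ι ⊕ ι → F) :
    ∃ w, ∀ x, twistedForm v (g.1 *ᵥ x) = twistedForm w x := by
  have htwo : (2 : F) = 0 := CharTwo.two_eq_zero
  have hsq : ∀ a : F, (frobeniusEquiv F 2).symm a ^ 2 = a := frobeniusEquiv_symm_pow_p F 2
  have hinj : ∀ a b : F, a ^ 2 = b ^ 2 → a = b := fun a b hab => by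
    apply (frobeniusEquiv F 2).injective
    simpa [frobeniusEquiv_apply, frobenius_def] using hab
  let l : (ι ⊕ ι → F) →ₗ[F] F :=
    { toFun := fun x => (frobeniusEquiv F 2).symm (twistedForm v (g.1 *ᵥ x) + splitForm x)
      map_add' := fun x y => by
        rw [← map_add]
        congr 1
        rw [Matrix.mulVec_add, twistedForm_add, splitForm_add, symplecticForm_map]
        linear_combination (ω x y) * htwo
      map_smul' := fun c x => by
        apply hinj
        rw [hsq, RingHom.id_apply, smul_eq_mul, mul_pow, hsq, Matrix.mulVec_smul,
          twistedForm_smul, splitForm_smul]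
        ring }
  obtain ⟨w, hw⟩ := exists_symplecticForm_eq l
  refine ⟨w, fun x => ?_⟩
  rw [twistedForm.eq_1 w, hw]
  change _ = _ + (frobeniusEquiv F 2).symm _ ^ 2
  rw [hsq]
  linear_combination (-splitForm x) * htwo

theorem exists_mem_formStabilizer_of_not_dvd_card {p n : ℕ} [Fact p.Prime]
    {g : symplecticGroup ι F} (hg : g ^ p ^ n = 1) (S : Set (ι ⊕ ι → F))
    (hS : ∀ v ∈ S, ∃ w ∈ S, ∀ x, twistedForm v (g.1 *ᵥ x) = twistedForm w x)
    (hp : ¬ p ∣ Nat.card S) : ∃ v ∈ S, g ∈ formStabilizer v := by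
  classical
  have := Fintype.ofFinite S
  choose f hfS hf using hS
  let σ : S → S := fun v => ⟨f v.1 v.2, hfS v.1 v.2⟩
  have hσ : ∀ v : S, ∀ x, twistedForm v.1 (g.1 *ᵥ x) = twistedForm (σ v).1 x :=
    fun v x => hf v.1 v.2 x
  have hinj : Function.Injective σ := by
    intro v w h
    refine Subtype.ext (twistedForm_injective (funext fun x => ?_))
    rw [← mulVec_inv_mulVec g x, hσ, hσ, h]
  let τ : Equiv.Perm S := Equiv.ofBijective σ hinj.bijective_of_finite
  have hτ : ∀ (k : ℕ) (v : S) (x), twistedForm v.1 ((g ^ k).1 *ᵥ x) =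
      twistedForm ((τ ^ k) v).1 x := by
    intro k
    induction k with
    | zero => intro v x; simp
    | succ k ih =>
      intro v x
      rw [pow_succ', Submonoid.coe_mul, ← Matrix.mulVec_mulVec, hσ, pow_succ, Equiv.Perm.mul_apply,
        ← ih]
      rfl
  obtain ⟨v, hv⟩ := Equiv.Perm.exists_fixed_point_of_prime (n := n)
    (by rwa [← Nat.card_eq_fintype_card]) (σ := τ) (by
      ext1 v
      refine Subtype.ext (twistedForm_injective (funext fun x => ?_))
      rw [← hτ, hg]
      simp)
  refine ⟨v.1, v.2, fun x => ?_⟩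
  rw [hσ]
  exact congrArg (fun u : S => twistedForm u.1 x) hv

theorem card_eq_two_pow (F : Type*) [Field F] [CharP F 2] [Finite F] :
    ∃ n, 0 < n ∧ Nat.card F = 2 ^ n := by
  have := Fintype.ofFinite F
  obtain ⟨n, -, hn⟩ := FiniteField.card F 2
  exact ⟨n, n.pos, by rw [Nat.card_eq_fintype_card, hn]⟩

theorem exists_mem_formStabilizer {p n : ℕ} [Fact p.Prime] (hp : p ≠ 2)
    {g : symplecticGroup ι F} (hg : g ^ p ^ n = 1) : ∃ v, g ∈ formStabilizer v := by
  obtain ⟨v, -, hv⟩ := exists_mem_formStabilizer_of_not_dvd_card hg Set.univ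
    (fun v _ => by simpa using exists_twistedForm_comp g v) (by
      obtain ⟨k, -, hk⟩ := card_eq_two_pow F
      rw [Nat.card_univ, Nat.card_fun, hk, ← pow_mul]
      intro h
      exact hp ((Nat.prime_dvd_prime_iff_eq Fact.out Nat.prime_two).1
        ((Fact.out : p.Prime).dvd_of_dvd_pow h)))
  exact ⟨v, hv⟩

theorem exists_conj_mem_of_not_dvd {p n : ℕ} [Fact p.Prime] (hp : p ≠ 2)
    (hpq : ¬ p ∣ Nat.card F ^ Fintype.card ι - 1) {g : symplecticGroup ι F} (hg : g ^ p ^ n = 1)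
    {v : ι ⊕ ι → F} (hv : splitForm v ∉ (artinSchreier F).range) :
    ∃ k : symplecticGroup ι F, k * g * k⁻¹ ∈ formStabilizer v := by
  set P := (artinSchreier F).range with hPdef
  have hP : P.index = 2 := index_range_artinSchreier F
  let O : Set (ι ⊕ ι → F) :=
    {w | ∃ k : symplecticGroup ι F, ∀ x, twistedForm v (k.1 *ᵥ x) = twistedForm w x}
  have hO : ∀ w ∈ O, ∀ u, splitForm w + splitForm u ∈ P → u ∈ O := by
    rintro w ⟨k, hk⟩ u hu
    obtain ⟨g, hg⟩ := exists_twistedForm_eq (v := w) (w := u) hu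
    exact ⟨k * g, fun x => by
      rw [Submonoid.coe_mul, ← Matrix.mulVec_mulVec, hk, hg]⟩
  have hvO : v ∈ O := ⟨1, by simp⟩
  have hpp : p.Prime := Fact.out
  have hpow : ∀ k, ¬ p ∣ 2 ^ k := fun k h =>
    hp ((Nat.prime_dvd_prime_iff_eq hpp Nat.prime_two).1 (hpp.dvd_of_dvd_pow h))
  obtain ⟨e, -, he⟩ := card_eq_two_pow F
  have hcard : ¬ p ∣ Nat.card O := by
    by_cases hS : O = {w : ι ⊕ ι → F | splitForm w ∉ P}
    · have h2 := two_mul_card_splitForm_notMem (ι := ι) hP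
      rw [← hS] at h2
      intro h
      have h3 : p ∣ 2 * Nat.card O := h.mul_left 2
      rw [h2, hpp.dvd_mul] at h3
      rcases h3 with h3 | h3
      · exact hpq h3
      · rw [he, ← pow_mul] at h3
        exact hpow _ h3
    · have : O = Set.univ := by
        have hsub : ∀ u, splitForm u ∉ P → u ∈ O := fun u hu =>
          hO v hvO u ((AddSubgroup.add_mem_iff_of_index_two hP).2 (iff_of_false hv hu))
        have hex : ∃ w ∈ O, splitForm w ∈ P := by
          by_contra! hcon
          exact hS (Set.Subset.antisymm (fun w hw => hcon w hw) hsub)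
        obtain ⟨w, hw, hwP⟩ := hex
        refine Set.eq_univ_of_forall fun u => ?_
        by_cases hu : splitForm u ∈ P
        · exact hO w hw u (P.add_mem hwP hu)
        · exact hsub u hu
      rw [this, Nat.card_univ, Nat.card_fun, he, ← pow_mul]
      exact hpow _
  obtain ⟨w, ⟨k, hk⟩, hw⟩ := exists_mem_formStabilizer_of_not_dvd_card hg O (by
    rintro w ⟨k, hk⟩
    obtain ⟨u, hu⟩ := exists_twistedForm_comp g w
    exact ⟨u, ⟨k * g, fun x => by
      rw [Submonoid.coe_mul, ← Matrix.mulVec_mulVec, hk, hu]⟩, hu⟩) hcard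
  exact ⟨k, exists_conj_mem_of_twistedForm_eq hw hk⟩

theorem exists_conj_mem_of_hyperbolic_pair {g : symplecticGroup ι F} {w x y : ι ⊕ ι → F}
    (hw : g ∈ formStabilizer w) (hx : g.1 *ᵥ x = x) (hy : g.1 *ᵥ y = y) (hxy : ω x y ≠ 0)
    {v : ι ⊕ ι → F} (hv : splitForm v ∉ (artinSchreier F).range) :
    ∃ k : symplecticGroup ι F, k * g * k⁻¹ ∈ formStabilizer v := by
  have htwo : (2 : F) = 0 := CharTwo.two_eq_zero
  have hP := index_range_artinSchreier F
  suffices h : ∃ s t : F, splitForm (w + (s • x + t • y)) ∉ (artinSchreier F).range by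
    obtain ⟨s, t, hst⟩ := h
    obtain ⟨k, hk⟩ := exists_twistedForm_eq (v := v) (w := w + (s • x + t • y))
      ((AddSubgroup.add_mem_iff_of_index_two hP).2 (iff_of_false hv hst))
    refine ⟨k, exists_conj_mem_of_twistedForm_eq (fun z => ?_) hk⟩
    have hfix : g.1 *ᵥ (s • x + t • y) = s • x + t • y := by
      rw [Matrix.mulVec_add, Matrix.mulVec_smul, Matrix.mulVec_smul, hx, hy]
    rw [twistedForm_add_left, twistedForm_add_left, hw]
    conv_lhs => rw [← hfix, symplecticForm_map]
  by_contra! hcon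
  apply hv
  obtain ⟨c, hc⟩ : ∃ c, c * ω x y = splitForm v := ⟨splitForm v / ω x y, div_mul_cancel₀ _ hxy⟩
  have key := add_mem (add_mem (hcon 1 c) (hcon 1 0)) (add_mem (hcon 0 c) (hcon 0 0))
  convert key using 1
  simp only [splitForm_add, splitForm_smul, map_add, map_smul, LinearMap.smul_apply, smul_eq_mul]
  linear_combination -hc - (2 * splitForm w + splitForm x + c ^ 2 * splitForm y + ω w x +
    c * ω w y) * htwo

end Conjugacy

section Degree

variable {ι F : Type*} [Fintype ι] [DecidableEq ι] [Field F]

local notation "ω" => symplecticForm ι F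

theorem symplecticForm_mulVec_left (g : symplecticGroup ι F) (x y : ι ⊕ ι → F) :
    ω (g.1 *ᵥ x) y = ω x ((g⁻¹).1 *ᵥ y) := by
  conv_lhs => rw [← mulVec_inv_mulVec g y, symplecticForm_map]

theorem symplecticForm_inv_mulVec_left (g : symplecticGroup ι F) (x y : ι ⊕ ι → F) :
    ω ((g⁻¹).1 *ᵥ x) y = ω x (g.1 *ᵥ y) := by
  conv_lhs => rw [← inv_mulVec_mulVec g y, symplecticForm_map]

theorem symplecticForm_aeval_add_inv_left (g : symplecticGroup ι F) (h : F[X])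
    (x y : ι ⊕ ι → F) :
    ω (aeval (g.1 + (g⁻¹).1) h *ᵥ x) y = ω x (aeval (g.1 + (g⁻¹).1) h *ᵥ y) := by
  have hA : ∀ x y, ω ((g.1 + (g⁻¹).1) *ᵥ x) y = ω x ((g.1 + (g⁻¹).1) *ᵥ y) := by
    intro x y
    rw [Matrix.add_mulVec, Matrix.add_mulVec, map_add, map_add, LinearMap.add_apply,
      symplecticForm_mulVec_left, symplecticForm_inv_mulVec_left, add_comm]
  have hpow : ∀ (k : ℕ) (x y), ω ((g.1 + (g⁻¹).1) ^ k *ᵥ x) y =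
      ω x ((g.1 + (g⁻¹).1) ^ k *ᵥ y) := by
    intro k
    induction k with
    | zero => simp
    | succ k ih =>
      intro x y
      rw [pow_succ, ← Matrix.mulVec_mulVec, ih, hA, Matrix.mulVec_mulVec, ← pow_succ', pow_succ]
  induction h using Polynomial.induction_on' with
  | add p q hp hq =>
    rw [map_add, Matrix.add_mulVec, Matrix.add_mulVec, map_add, map_add, LinearMap.add_apply,
      hp, hq]
  | monomial k c =>
    rw [aeval_monomial, ← Algebra.smul_def, Matrix.smul_mulVec, Matrix.smul_mulVec, map_smul,
      map_smul, LinearMap.smul_apply, hpow]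

variable [CharP F 2]

theorem symplecticForm_aeval_add_inv_self (g : symplecticGroup ι F) (h : F[X])
    (x : ι ⊕ ι → F) : ω x (aeval (g.1 + (g⁻¹).1) h *ᵥ x) = 0 := by
  induction h using Polynomial.induction_on' with
  | add p q hp hq => rw [map_add, Matrix.add_mulVec, map_add, hp, hq, add_zero]
  | monomial k c =>
    rw [aeval_monomial, ← Algebra.smul_def, Matrix.smul_mulVec, map_smul]
    have hpow : ∀ (j : ℕ) (y), ω x ((g.1 + (g⁻¹).1) ^ j *ᵥ y) =
        ω ((g.1 + (g⁻¹).1) ^ j *ᵥ x) y := by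
      intro j y
      simpa using (symplecticForm_aeval_add_inv_left g (X ^ j) x y).symm
    obtain ⟨j, rfl | rfl⟩ := Nat.even_or_odd' k
    · rw [two_mul, pow_add, ← Matrix.mulVec_mulVec, hpow, symplecticForm_self, smul_zero]
    · rw [two_mul, add_assoc, pow_add, pow_succ', ← Matrix.mulVec_mulVec, hpow,
        ← Matrix.mulVec_mulVec, Matrix.add_mulVec, map_add, ← symplecticForm_mulVec_left,
        symplecticForm_comm (g.1 *ᵥ _), CharTwo.add_self_eq_zero, smul_zero]

/-- The irreducible factors of the characteristic polynomial of `g + g⁻¹` have degree at most half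
the dimension, because cyclic subspaces of `g + g⁻¹` are totally isotropic. -/
theorem natDegree_le_card_of_not_isUnit_aeval (g : symplecticGroup ι F) {f : F[X]}
    (hf : Irreducible f) (h : ¬ IsUnit (aeval (g.1 + (g⁻¹).1) f)) :
    f.natDegree ≤ Fintype.card ι := by
  set A := g.1 + (g⁻¹).1 with hA
  obtain ⟨x, hx, hfx⟩ : ∃ x, x ≠ 0 ∧ aeval A f *ᵥ x = 0 := by
    rw [Matrix.exists_mulVec_eq_zero_iff]
    by_contra hdet
    exact h ((Matrix.isUnit_iff_isUnit_det _).2 (isUnit_iff_ne_zero.2 hdet))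
  let φ : degreeLT F f.natDegree →ₗ[F] (ι ⊕ ι → F) :=
    { toFun := fun r => aeval A r.1 *ᵥ x
      map_add' := fun r s => by
        rw [Submodule.coe_add, map_add, Matrix.add_mulVec]
      map_smul' := fun c r => by
        rw [Submodule.coe_smul, map_smul, Matrix.smul_mulVec, RingHom.id_apply] }
  have hφ : Function.Injective φ := by
    rw [injective_iff_map_eq_zero]
    rintro ⟨r, hr⟩ hr0
    change aeval A r *ᵥ x = 0 at hr0
    rw [mem_degreeLT] at hr
    by_contra hne
    have hrne : r ≠ 0 := fun h0 => hne (Subtype.ext h0)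
    have hndvd : ¬ f ∣ r := fun hdvd => by
      have := degree_le_of_dvd hdvd hrne
      rw [degree_eq_natDegree hf.ne_zero] at this
      exact absurd hr this.not_gt
    obtain ⟨a, b, hab⟩ := hf.coprime_iff_not_dvd.2 hndvd
    apply hx
    have := congrArg (fun s => aeval A s *ᵥ x) hab
    simpa [Matrix.add_mulVec, ← Matrix.mulVec_mulVec, hfx, hr0] using this.symm
  have hrank : Module.finrank F (LinearMap.range φ) = f.natDegree := by
    rw [LinearMap.finrank_range_of_inj hφ, (degreeLTEquiv F f.natDegree).finrank_eq]
    simp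
  have hiso : LinearMap.range φ ≤ LinearMap.BilinForm.orthogonal ω (LinearMap.range φ) := by
    rintro _ ⟨r, rfl⟩
    rw [LinearMap.BilinForm.mem_orthogonal_iff]
    rintro _ ⟨s, rfl⟩
    change ω (aeval A s.1 *ᵥ x) (aeval A r.1 *ᵥ x) = 0
    rw [symplecticForm_aeval_add_inv_left, Matrix.mulVec_mulVec, ← map_mul,
      symplecticForm_aeval_add_inv_self]
  have hle := Submodule.finrank_mono hiso
  rw [LinearMap.BilinForm.finrank_orthogonal nondegenerate_symplecticForm, hrank] at hle
  simp only [Module.finrank_fintype_fun_eq_card, Fintype.card_sum] at hle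
  omega

/-- A symplectic matrix of odd prime power order `n` has an eigenvalue of order `n`. -/
theorem exists_isPrimitiveRoot_of_orderOf {L : Type*} [Field L] [IsAlgClosed L] [Algebra F L]
    {p a : ℕ} (hp : p.Prime) (hp2 : p ≠ 2) (g : symplecticGroup ι F)
    (hg : orderOf g = p ^ (a + 1)) :
    ∃ ζ : L, IsPrimitiveRoot ζ (p ^ (a + 1)) ∧
      ¬ IsUnit (aeval (g.1 + (g⁻¹).1) (minpoly F (ζ + ζ⁻¹))) := by
  have : Fact p.Prime := ⟨hp⟩
  have : CharP L 2 := charP_of_injective_algebraMap (algebraMap F L).injective 2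
  let Ψ : Matrix (ι ⊕ ι) (ι ⊕ ι) F →ₐ[F] Matrix (ι ⊕ ι) (ι ⊕ ι) L :=
    (Algebra.ofId F L).mapMatrix
  have hΨ : Function.Injective Ψ := Matrix.map_injective (algebraMap F L).injective
  set M := Ψ g.1 with hM
  have hMpow : ∀ k, M ^ k = 1 ↔ g ^ k = 1 := by
    intro k
    rw [hM, ← map_pow, ← map_one Ψ, hΨ.eq_iff, ← SubmonoidClass.coe_pow, ← Submonoid.coe_one,
      Subtype.coe_inj]
  have hM1 : M ^ p ^ (a + 1) = 1 := by rw [hMpow, ← hg, pow_orderOf_eq_one]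
  have hM2 : M ^ p ^ a ≠ 1 := by
    rw [Ne, hMpow]
    intro h
    have := Nat.le_of_dvd (pow_pos hp.pos a) (orderOf_dvd_of_pow_eq_one h)
    rw [hg] at this
    exact absurd this (Nat.pow_lt_pow_right hp.one_lt a.lt_succ_self).not_ge
  have hcyc : ¬ IsUnit (aeval M (cyclotomic (p ^ (a + 1)) L)) := by
    intro hu
    apply hM2
    have h := congrArg (aeval M) (cyclotomic_prime_pow_mul_X_pow_sub_one L p a)
    simp only [map_mul, map_sub, map_pow, aeval_X, map_one, hM1, sub_self] at h
    exact sub_eq_zero.1 ((hu.mul_right_eq_zero).1 h)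
  rw [(IsAlgClosed.splits (cyclotomic (p ^ (a + 1)) L)).eq_prod_roots_of_monic
    (cyclotomic.monic _ _)] at hcyc
  obtain ⟨ζ, hζ, hζ0⟩ := spectrum.exists_mem_of_not_isUnit_aeval_prod hcyc
  have : NeZero ((p ^ (a + 1) : ℕ) : L) := ⟨fun h => by
    rw [CharP.cast_eq_zero_iff L 2] at h
    exact hp2 ((Nat.prime_dvd_prime_iff_eq Nat.prime_two hp).1
      (Nat.prime_two.dvd_of_dvd_pow h)).symm⟩
  have hprim : IsPrimitiveRoot ζ (p ^ (a + 1)) := isRoot_cyclotomic_iff.1 hζ0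
  refine ⟨ζ, hprim, fun hu => ?_⟩
  have hpos : 0 < p ^ (a + 1) := pow_pos hp.pos _
  have hζinv : ζ⁻¹ = ζ ^ (p ^ (a + 1) - 1) := by
    apply inv_eq_of_mul_eq_one_right
    rw [← pow_succ', Nat.sub_add_cancel hpos, hprim.pow_eq_one]
  have hginv : (g⁻¹ : symplecticGroup ι F).1 = g.1 ^ (p ^ (a + 1) - 1) := by
    rw [← SubmonoidClass.coe_pow]
    congr 1
    rw [inv_eq_iff_mul_eq_one, ← pow_succ', Nat.sub_add_cancel hpos, ← hg, pow_orderOf_eq_one]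
  have h1 := spectrum.subset_polynomial_aeval M (X + X ^ (p ^ (a + 1) - 1)) ⟨ζ, hζ, rfl⟩
  have h2 : aeval M (X + X ^ (p ^ (a + 1) - 1) : L[X]) = Ψ (g.1 + (g⁻¹).1) := by
    rw [hginv]
    simp [hM]
  rw [h2] at h1
  have h3 := spectrum.subset_polynomial_aeval _ ((minpoly F (ζ + ζ⁻¹)).map (algebraMap F L))
    ⟨_, h1, rfl⟩
  simp only [eval_add, eval_X, eval_pow, ← hζinv, eval_map_algebraMap, minpoly.aeval,
    aeval_map_algebraMap, spectrum.zero_mem_iff] at h3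
  apply h3
  rw [aeval_algHom_apply]
  exact hu.map Ψ

end Degree

section Construction

variable {ι F : Type*} [Fintype ι] [DecidableEq ι] [Field F] [CharP F 2]

local notation "ω" => symplecticForm ι F

/-- Restriction of scalars of the companion matrix of `X ^ 2 + c X + 1` from a Frobenius
algebra `R` with form `τ`. -/
theorem exists_symplectic_of_frobenius_form {R L : Type*} [CommRing R] [Algebra F R]
    [Field L] [Algebra F L] (b : Module.Basis ι F R) (τ : R →ₗ[F] F)
    (hτ : ∀ x, (∀ y, τ (x * y) = 0) → x = 0) (c ε : R) (hcε : c * ε = 0) (hε : τ (ε * ε) ≠ 0)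
    (π : R →ₐ[F] L) (ζ : L) (hζ : ζ ≠ 0) (hπ : π c = ζ + ζ⁻¹) :
    ∃ u : symplecticGroup ι F, (∀ n, u ^ n = 1 → ζ ^ n = 1) ∧
      ∃ x y, (u ^ 2).1 *ᵥ x = x ∧ (u ^ 2).1 *ᵥ y = y ∧ ω x y ≠ 0 := by
  have : CharP L 2 := charP_of_injective_algebraMap (algebraMap F L).injective 2
  let β : LinearMap.BilinForm F R := (LinearMap.mul F R).compr₂ τ
  have hβ : ∀ x y, β x y = τ (x * y) := fun x y => rfl
  have hβn : β.Nondegenerate :=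
    ⟨fun x hx => hτ x hx, fun y hy => hτ y fun x => by rw [mul_comm]; exact hy x⟩
  set T := LinearMap.BilinForm.toMatrix b β with hT
  have hTdet : IsUnit T.det :=
    ((LinearMap.BilinForm.nondegenerate_iff_det_ne_zero b).1 hβn).isUnit
  have hTsymm : Tᵀ = T := by
    ext i j
    simp only [Matrix.transpose_apply, hT, LinearMap.BilinForm.toMatrix_apply, hβ]
    rw [mul_comm]
  have hTinvsymm : (T⁻¹)ᵀ = T⁻¹ := by rw [Matrix.transpose_nonsing_inv, hTsymm]
  set C := Algebra.leftMulMatrix b c with hC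
  have hTC : (T * C)ᵀ = T * C := by
    rw [hT, hC, Algebra.leftMulMatrix_apply, ← LinearMap.BilinForm.toMatrix_compRight]
    ext i j
    simp only [Matrix.transpose_apply, LinearMap.BilinForm.toMatrix_apply,
      LinearMap.BilinForm.compRight_apply, hβ, Algebra.coe_lmul_eq_mul, LinearMap.mul_apply']
    congr 1
    ring
  have hTT : T * T⁻¹ = 1 := Matrix.mul_nonsing_inv T hTdet
  have hTT' : T⁻¹ * T = 1 := Matrix.nonsing_inv_mul T hTdet
  let M : Matrix (ι ⊕ ι) (ι ⊕ ι) F := Matrix.fromBlocks 0 T⁻¹ T Cᵀ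
  have hM : M ∈ symplecticGroup ι F := by
    rw [SymplecticGroup.mem_iff]
    simp only [M, J, Matrix.fromBlocks_transpose, Matrix.fromBlocks_multiply, hTsymm, hTinvsymm]
    rw [Matrix.transpose_mul, hTsymm] at hTC
    have hneg : (-1 : Matrix ι ι F) = 1 := by
      ext i j
      simp [CharTwo.neg_eq]
    have hadd : T * C + T * C = 0 := by
      ext i j
      exact CharTwo.add_self_eq_zero _
    simp [hTT, hTT', hTC, hneg, hadd]
  refine ⟨⟨M, hM⟩, fun n hn => ?_, Sum.elim (b.repr ε) 0, Sum.elim 0 (T *ᵥ b.repr ε), ?_, ?_, ?_⟩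
  · let α := (algebraMap F L).mapMatrix (m := ι)
    let r : ι → L := fun j => π (b j)
    have hr : r ≠ 0 := by
      intro h0
      have : (π.toLinearMap : R →ₗ[F] L) = 0 := b.ext fun j => congrFun h0 j
      have h1 := LinearMap.congr_fun this 1
      simp at h1
    have hCr : (Cᵀ).map (algebraMap F L) *ᵥ r = (ζ + ζ⁻¹) • r := by
      ext k
      have h1 := congrArg π (b.sum_repr (c * b k))
      simp only [map_sum, map_smul, map_mul, hπ] at h1
      simp only [Matrix.mulVec, dotProduct, Matrix.map_apply, Matrix.transpose_apply, hC,
        Algebra.leftMulMatrix_eq_repr_mul, Pi.smul_apply, smul_eq_mul, r]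
      rw [← h1]
      exact Finset.sum_congr rfl fun j _ => (Algebra.smul_def _ _).symm
    have hTr : T.map (algebraMap F L) *ᵥ (T⁻¹).map (algebraMap F L) *ᵥ r = r := by
      rw [Matrix.mulVec_mulVec, ← Matrix.map_mul, hTT, Matrix.map_one _ (map_zero _) (map_one _),
        Matrix.one_mulVec]
    let z : ι ⊕ ι → L := Sum.elim (ζ⁻¹ • (T⁻¹).map (algebraMap F L) *ᵥ r) r
    have hz : M.map (algebraMap F L) *ᵥ z = ζ • z := by
      simp only [M, z, Matrix.fromBlocks_map, Matrix.fromBlocks_mulVec, Sum.elim_comp_inl,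
        Sum.elim_comp_inr, hCr, Matrix.mulVec_smul, hTr]
      ext (i | i)
      · simp [hζ]
      · simp only [Sum.elim_inr, Pi.add_apply, Pi.smul_apply, smul_eq_mul]
        linear_combination (ζ⁻¹ * r i) * CharTwo.two_eq_zero (R := L)
    have hzn : ∀ n : ℕ, (M ^ n).map (algebraMap F L) *ᵥ z = ζ ^ n • z := by
      intro n
      induction n with
      | zero => simp
      | succ n ih =>
        rw [pow_succ, Matrix.map_mul, ← Matrix.mulVec_mulVec, hz, Matrix.mulVec_smul, ih,
          smul_smul, pow_succ']
    have hMn : M ^ n = 1 := congrArg Subtype.val hn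
    obtain ⟨j, hj⟩ := Function.ne_iff.1 hr
    have h2 := congrFun (hzn n) (Sum.inr j)
    rw [hMn, Matrix.map_one _ (map_zero _) (map_one _), Matrix.one_mulVec] at h2
    exact mul_right_cancel₀ hj (by simpa [z] using h2.symm)
  all_goals
    have hCε : C *ᵥ b.repr ε = 0 := by
      rw [hC, Algebra.leftMulMatrix_mulVec_repr, hcε]
      simp
    have hCTε : Cᵀ *ᵥ T *ᵥ b.repr ε = 0 := by
      rw [Matrix.transpose_mul, hTsymm] at hTC
      rw [Matrix.mulVec_mulVec, hTC, ← Matrix.mulVec_mulVec, hCε, Matrix.mulVec_zero]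
    have hTTε : T⁻¹ *ᵥ T *ᵥ b.repr ε = b.repr ε := by
      rw [Matrix.mulVec_mulVec, hTT', Matrix.one_mulVec]
  · rw [SubmonoidClass.coe_pow, sq, ← Matrix.mulVec_mulVec]
    simp [M, Matrix.fromBlocks_mulVec, hCTε, hTTε]
  · rw [SubmonoidClass.coe_pow, sq, ← Matrix.mulVec_mulVec]
    simp [M, Matrix.fromBlocks_mulVec, hCTε, hTTε]
  · rw [symplecticForm_apply]
    simp only [Sum.elim_inl, Sum.elim_inr, Pi.zero_apply, mul_zero, add_zero]
    change b.repr ε ⬝ᵥ _ ≠ 0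
    rw [hT, LinearMap.BilinForm.dotProduct_toMatrix_mulVec]
    rwa [show b.equivFun.symm (b.repr ε) = ε from b.equivFun.symm_apply_apply ε, hβ]

end Construction

section TwoElements

variable {F : Type*} [Field F]

variable (F) in
/-- A single unipotent Jordan block of size `m - 1`, extended by a fixed vector. -/
def jordanMatrix (m : ℕ) : Matrix (Fin m) (Fin m) F :=
  1 + (Matrix.of fun i j => if (j : ℕ) + 1 = i ∧ (i : ℕ) + 1 < m then 1 else 0 :
    Matrix (Fin m) (Fin m) F)

variable (F) in
/-- The first `m - 1` binomial coefficients `n.choose i`, followed by a zero. -/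
def chooseVec (m n : ℕ) : Fin m → F := fun i => if (i : ℕ) + 1 < m then (n.choose i : F) else 0

theorem jordanMatrix_mulVec_chooseVec (m n : ℕ) :
    jordanMatrix F m *ᵥ chooseVec F m n = chooseVec F m (n + 1) := by
  ext ⟨i, hi⟩
  rw [jordanMatrix, Matrix.add_mulVec, Matrix.one_mulVec, Pi.add_apply]
  simp only [Matrix.mulVec, dotProduct, Matrix.of_apply, chooseVec]
  by_cases him : i + 1 < m
  · cases i with
    | zero => simp [him]
    | succ i =>
      rw [Finset.sum_eq_single_of_mem ⟨i, by omega⟩ (Finset.mem_univ _)]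
      · rw [if_pos him, if_pos him, if_pos ⟨rfl, him⟩, if_pos (Nat.lt_of_succ_lt him),
          Nat.choose_succ_succ, Nat.cast_add, one_mul, add_comm]
      · intro j _ hj
        rw [if_neg, zero_mul]
        rintro ⟨h, -⟩
        exact hj (Fin.ext (by simpa using h))
  · simp [him]

variable [CharP F 2]

theorem matrix_pow_two_pow_eq_one_iff {ι : Type*} [Fintype ι] [DecidableEq ι]
    (M : Matrix ι ι F) (n : ℕ) : M ^ 2 ^ n = 1 ↔ (M - 1) ^ 2 ^ n = 0 := by
  cases isEmpty_or_nonempty ι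
  · exact ⟨fun _ => Subsingleton.elim _ _, fun _ => Subsingleton.elim _ _⟩
  · rw [sub_pow_char_pow_of_commute (p := 2) (h := Commute.one_right M), one_pow, sub_eq_zero]

theorem pow_two_pow_eq_one_of_card_le {ι : Type*} [Fintype ι] [DecidableEq ι]
    {M : Matrix ι ι F} {n k : ℕ} (hM : M ^ 2 ^ n = 1) (hk : Fintype.card ι ≤ 2 ^ k) :
    M ^ 2 ^ k = 1 := by
  rw [matrix_pow_two_pow_eq_one_iff] at hM ⊢
  have h := isNilpotent_charpoly_sub_pow_of_isNilpotent (M := M - 1) ⟨_, hM⟩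
  have h1 := aeval_self_charpoly (M - 1)
  rw [sub_eq_zero.1 h.eq_zero, map_pow, aeval_X] at h1
  exact pow_eq_zero_of_le hk h1

theorem sum_choose_mul_choose (b : ℕ) :
    ∑ j ∈ Finset.range (2 ^ (b + 1)), (j.choose (2 ^ b) : F) * (j.choose (2 ^ b - 1) : F) = 1 := by
  set r := 2 ^ b with hr
  have hr0 : 0 < r := by positivity
  have hchoose : ∀ i k : ℕ, ((r + i).choose k : F) =
      (if r ≤ k then (i.choose (k - r) : F) else 0) + (i.choose k : F) := by
    intro i k
    rw [← coeff_X_add_one_pow, pow_add, hr, add_pow_char_pow, one_pow, add_mul, one_mul,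
      coeff_add, coeff_X_pow_mul', coeff_X_add_one_pow, coeff_X_add_one_pow]
  rw [pow_succ, ← hr, mul_two, Finset.sum_range_add, Finset.sum_eq_zero, zero_add]
  · rw [Finset.sum_eq_single_of_mem (r - 1) (by rw [Finset.mem_range]; omega)]
    · rw [hchoose, hchoose]
      simp [Nat.choose_eq_zero_of_lt (Nat.sub_lt hr0 one_pos), hr0]
    · intro i hi hne
      rw [Finset.mem_range] at hi
      rw [hchoose i (r - 1), if_neg (by omega), Nat.choose_eq_zero_of_lt (by omega : i < r - 1)]
      simp
  · intro j hj
    rw [Nat.choose_eq_zero_of_lt (Finset.mem_range.1 hj)]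
    simp

theorem jordanMatrix_pow_eq_one (m : ℕ) : ∃ s, jordanMatrix F m ^ 2 ^ s = 1 := by
  have htri : (jordanMatrix F m)ᵀ.BlockTriangular id := by
    intro i j hij
    have hij' : (j : ℕ) < i := hij
    simp only [jordanMatrix, Matrix.transpose_apply, Matrix.add_apply, Matrix.of_apply]
    rw [Matrix.one_apply_ne (ne_of_lt hij : j ≠ i), if_neg (by omega), add_zero]
  have hdiag : ∀ i, (jordanMatrix F m)ᵀ i i = 1 := by
    intro i
    simp [jordanMatrix]
  have h := aeval_self_charpoly (jordanMatrix F m)ᵀ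
  rw [Matrix.charpoly_of_isUpperTriangular _ htri] at h
  simp only [hdiag, Finset.prod_const, Finset.card_univ, Fintype.card_fin, map_pow, map_sub,
    aeval_X, map_one] at h
  refine ⟨m, Matrix.transpose_injective ?_⟩
  rw [Matrix.transpose_pow, Matrix.transpose_one, matrix_pow_two_pow_eq_one_iff]
  exact pow_eq_zero_of_le m.lt_two_pow_self.le h

/-- A 2-element of large order that fixes a quadratic form and a hyperbolic pair. -/
theorem exists_two_element {m b : ℕ} (hb : 2 ^ b + 1 < m) :
    ∃ u : symplecticGroup (Fin m) F, (∃ t, u ^ 2 ^ t = 1) ∧ u ^ 2 ^ (b + 1) ≠ 1 ∧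
      ∃ w x y, u ∈ formStabilizer w ∧ u.1 *ᵥ x = x ∧ u.1 *ᵥ y = y ∧
        symplecticForm (Fin m) F x y ≠ 0 := by
  have hb0 : 0 < 2 ^ b := by positivity
  set B := jordanMatrix F m with hB
  obtain ⟨s, hs⟩ := jordanMatrix_pow_eq_one (F := F) m
  rw [← hB] at hs
  obtain ⟨A, hBA, hAB⟩ : ∃ A, B * A = 1 ∧ A * B = 1 := by
    refine ⟨B ^ (2 ^ s - 1), ?_, ?_⟩
    · rw [← pow_succ', Nat.sub_add_cancel Nat.one_le_two_pow, hs]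
    · rw [← pow_succ, Nat.sub_add_cancel Nat.one_le_two_pow, hs]
  have hAs : A ^ 2 ^ s = 1 := by
    have hc : Commute B A := hBA.trans hAB.symm
    have h := hc.mul_pow (2 ^ s)
    rw [hBA, one_pow, hs, one_mul] at h
    exact h.symm
  let c := chooseVec F m
  have hBc : ∀ n, B *ᵥ c n = c (n + 1) := jordanMatrix_mulVec_chooseVec m
  let S := vecMulVec (c 0) (c 0)
  let Z : ℕ → Matrix (Fin m) (Fin m) F := fun n => ∑ j ∈ Finset.range n, vecMulVec (c j) (c j)
  have hZ : ∀ n, Z (n + 1) = S + B * Z n * Bᵀ := by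
    intro n
    simp only [Z, S, Finset.sum_range_succ', Finset.mul_sum, Finset.sum_mul, mul_vecMulVec,
      vecMulVec_mul, vecMul_transpose, hBc]
    rw [add_comm]
  have hSt : Sᵀ = S := by simp only [S, transpose_vecMulVec]
  let M : Matrix (Fin m ⊕ Fin m) (Fin m ⊕ Fin m) F := fromBlocks A (A * S) 0 Bᵀ
  have hAB' : Aᵀ * Bᵀ = 1 := by rw [← transpose_mul, hBA, transpose_one]
  have hBA' : Bᵀ * Aᵀ = 1 := by rw [← transpose_mul, hAB, transpose_one]
  have hM : M ∈ symplecticGroup (Fin m) F := by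
    rw [SymplecticGroup.mem_iff]
    simp only [M, J, fromBlocks_transpose, fromBlocks_multiply, transpose_mul, hSt,
      transpose_transpose, transpose_zero]
    simp [hAB, hBA', Matrix.mul_assoc]
  have hMpow : ∀ n, M ^ n = fromBlocks (A ^ n) (A ^ n * Z n) 0 (Bᵀ ^ n) := by
    intro n
    induction n with
    | zero => simp [Z]
    | succ n ih =>
      rw [pow_succ, ih, hZ]
      simp only [M, fromBlocks_multiply, pow_succ, Matrix.mul_zero, Matrix.zero_mul, add_zero,
        zero_add]
      congr 1
      rw [Matrix.mul_add, Matrix.mul_assoc, Matrix.mul_assoc, Matrix.mul_assoc B,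
        Matrix.mul_assoc, ← Matrix.mul_assoc A B, hAB, Matrix.one_mul]
  have hlast : m - 1 < m := by omega
  let l : Fin m := ⟨m - 1, hlast⟩
  let o : Fin m := ⟨0, by omega⟩
  have hc0 : c 0 = Pi.single o 1 := by
    ext ⟨i, hi⟩
    by_cases h : i = 0
    · subst h
      simp [c, chooseVec, o, (by omega : 1 < m)]
    · simp [c, chooseVec, o, h, Nat.choose_eq_zero_of_lt (Nat.pos_of_ne_zero h)]
  have hBl : B *ᵥ Pi.single l 1 = Pi.single l 1 := by
    rw [hB, jordanMatrix, add_mulVec, one_mulVec, add_eq_left]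
    ext i
    simp [l]
    omega
  have hBtl : Bᵀ *ᵥ Pi.single l 1 = Pi.single l 1 := by
    rw [hB, jordanMatrix, transpose_add, transpose_one, add_mulVec, one_mulVec, add_eq_left]
    ext i
    simp [l]
    omega
  have hBto : Bᵀ *ᵥ Pi.single o 1 = Pi.single o 1 := by
    rw [hB, jordanMatrix, transpose_add, transpose_one, add_mulVec, one_mulVec, add_eq_left]
    ext i
    simp [o]
  have hAl : A *ᵥ Pi.single l 1 = Pi.single l 1 := by
    conv_lhs => rw [← hBl, mulVec_mulVec, hAB, one_mulVec]
  have hAto : Aᵀ *ᵥ Pi.single o 1 = Pi.single o 1 := by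
    conv_lhs => rw [← hBto, mulVec_mulVec, hAB', one_mulVec]
  have hlo : l ≠ o := by
    simp only [l, o, ne_eq, Fin.mk.injEq]
    omega
  have hMv : ∀ a b, M *ᵥ Sum.elim a b = Sum.elim (A *ᵥ (a + S *ᵥ b)) (Bᵀ *ᵥ b) := by
    intro a b
    simp only [M, fromBlocks_mulVec, Sum.elim_comp_inl, Sum.elim_comp_inr, zero_mulVec, zero_add,
      mulVec_add, mulVec_mulVec]
  have hSv : ∀ b, S *ᵥ b = b o • Pi.single o 1 := by
    intro b
    ext i
    simp only [S, vecMulVec_mulVec, hc0, single_one_dotProduct]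
    simp [mul_comm]
  have hAo : ∀ a, (A *ᵥ a) o = a o := by
    intro a
    rw [← single_one_dotProduct o (A *ᵥ a), dotProduct_mulVec, ← mulVec_transpose, hAto,
      single_one_dotProduct]
  have hsplit : ∀ a b : Fin m → F, splitForm (Sum.elim a b) = a ⬝ᵥ b := fun _ _ => rfl
  have hω : ∀ a b : Fin m → F,
      symplecticForm (Fin m) F (Sum.elim 0 (Pi.single o 1)) (Sum.elim a b) = a o := by
    intro a b
    rw [symplecticForm_apply]
    simp [Pi.single_apply]
  refine ⟨⟨M, hM⟩, ⟨s + 1, ?_⟩, ?_, Sum.elim 0 (Pi.single o 1), Sum.elim (Pi.single l 1) 0,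
    Sum.elim 0 (Pi.single l 1), ?_, ?_, ?_, ?_⟩
  · apply Subtype.ext
    rw [SubmonoidClass.coe_pow, pow_succ, pow_mul, hMpow, hAs, ← transpose_pow, hs]
    simp only [sq, fromBlocks_multiply, transpose_one, Matrix.mul_one, Matrix.one_mul,
      Matrix.mul_zero, Matrix.zero_mul, add_zero, zero_add]
    have : Z (2 ^ s) + Z (2 ^ s) = 0 := by
      ext i j
      exact CharTwo.add_self_eq_zero _
    rw [this, fromBlocks_one]
    rfl
  · intro h
    have h1 : M ^ 2 ^ (b + 1) = 1 := congrArg Subtype.val h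
    rw [hMpow, ← fromBlocks_one, fromBlocks_inj] at h1
    have h2 := congrFun (congrFun h1.2.1 ⟨2 ^ b, by omega⟩) ⟨2 ^ b - 1, by omega⟩
    rw [h1.1, Matrix.one_mul] at h2
    simp only [Z, Matrix.sum_apply, vecMulVec_apply, c, chooseVec, hb, if_true,
      (by omega : 2 ^ b - 1 + 1 < m), sum_choose_mul_choose, Matrix.zero_apply] at h2
    exact one_ne_zero h2
  · rw [mem_formStabilizer]
    intro x
    obtain ⟨a, b, rfl⟩ : ∃ a b, x = Sum.elim a b := ⟨_, _, (Sum.elim_comp_inl_inr x).symm⟩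
    rw [hMv, twistedForm, twistedForm, hω, hω, hsplit, hsplit, hAo, dotProduct_mulVec,
      vecMul_transpose, mulVec_mulVec, hBA, one_mulVec, hSv, add_dotProduct, smul_dotProduct,
      single_one_dotProduct]
    simp only [Pi.add_apply, Pi.smul_apply, Pi.single_eq_same, smul_eq_mul, mul_one]
    rw [CharTwo.add_sq]
    linear_combination (b o * b o) * CharTwo.two_eq_zero (R := F)
  · rw [hMv, mulVec_zero, mulVec_zero, add_zero, hAl]
  · rw [hMv, hSv, Pi.single_eq_of_ne hlo.symm, zero_smul, add_zero, mulVec_zero, hBtl]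
  · rw [symplecticForm_apply]
    simp [Pi.single_apply]

end TwoElements

section OddElements

variable {F : Type*} [Field F] [Finite F]

open IntermediateField in
theorem pow_card_pow_eq_iff_natDegree_minpoly_dvd {L : Type*} [Field L] [Algebra F L] {t : L}
    (ht : IsIntegral F t) (n : ℕ) :
    t ^ Nat.card F ^ n = t ↔ (minpoly F t).natDegree ∣ n := by
  have := Fintype.ofFinite F
  have := adjoin.finiteDimensional ht
  have : Finite F⟮t⟯ := Module.finite_of_finite F
  rw [← adjoin.finrank ht, ← FiniteField.orderOf_frobeniusAlgHom F F⟮t⟯, orderOf_dvd_iff_pow_eq_one]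
  have hpow : ∀ x, (FiniteField.frobeniusAlgHom F F⟮t⟯ ^ n) x = x ^ Nat.card F ^ n := by
    intro x
    rw [AlgHom.coe_pow, FiniteField.coe_frobeniusAlgHom, pow_iterate, Nat.card_eq_fintype_card]
  constructor
  · intro h
    refine algHom_ext_of_eq_adjoin _ rfl fun x hx => ?_
    obtain rfl := hx
    rw [hpow]
    exact Subtype.ext h
  · intro h
    have h1 := congrArg Subtype.val (hpow (AdjoinSimple.gen F t))
    rw [h] at h1
    simpa using h1.symm

variable [CharP F 2]

theorem add_inv_pow_card_pow_eq_iff {L : Type*} [Field L] [Algebra F L] {ζ : L} {N : ℕ}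
    (hζ : IsPrimitiveRoot ζ N) (hN : N ≠ 0) (n : ℕ) :
    (ζ + ζ⁻¹) ^ Nat.card F ^ n = ζ + ζ⁻¹ ↔
      N ∣ Nat.card F ^ n - 1 ∨ N ∣ Nat.card F ^ n + 1 := by
  have : CharP L 2 := charP_of_injective_algebraMap (algebraMap F L).injective 2
  obtain ⟨s, -, hs⟩ := card_eq_two_pow F
  have hζ0 : ζ ≠ 0 := hζ.ne_zero hN
  have hpos : 0 < Nat.card F ^ n := pow_pos Nat.card_pos n
  rw [← hζ.pow_eq_one_iff_dvd, ← hζ.pow_eq_one_iff_dvd]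
  set e := Nat.card F ^ n with he
  have hadd : (ζ + ζ⁻¹) ^ e = ζ ^ e + (ζ ^ e)⁻¹ := by
    rw [he, hs, ← pow_mul, add_pow_char_pow, inv_pow]
  have h1 : ζ ^ e = ζ * ζ ^ (e - 1) := by rw [← pow_succ', Nat.sub_add_cancel hpos]
  rw [hadd, pow_succ, h1]
  set z := ζ ^ (e - 1) with hz
  have hz0 : z ≠ 0 := pow_ne_zero _ hζ0
  have key : (ζ * z + (ζ * z)⁻¹) - (ζ + ζ⁻¹) = (z - 1) * (ζ * z * ζ - 1) / (ζ * z) := by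
    field_simp
    ring
  rw [← sub_eq_zero, key, div_eq_zero_iff, mul_eq_zero, sub_eq_zero, sub_eq_zero]
  simp [hζ0, hz0]

theorem natDegree_minpoly_add_inv_ne {L : Type*} [Field L] [Algebra F L] {ζ : L} {p a m : ℕ}
    (hp : p.Prime) (hp2 : p ≠ 2) (hζ : IsPrimitiveRoot ζ (p ^ a)) (hint : IsIntegral F (ζ + ζ⁻¹))
    (hm : Even m) (hm0 : m ≠ 0) (ha : a ≠ 0) (hpm : p ∣ Nat.card F ^ m - 1) :
    (minpoly F (ζ + ζ⁻¹)).natDegree ≠ m := by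
  intro hd
  have hN : p ^ a ≠ 0 := pow_ne_zero a hp.ne_zero
  have hcard : ∀ n, 0 < Nat.card F ^ n := fun n => pow_pos Nat.card_pos n
  have hnot : ∀ n, ¬ (p ∣ Nat.card F ^ n - 1 ∧ p ∣ Nat.card F ^ n + 1) := by
    rintro n ⟨h1, h2⟩
    have h3 := (Nat.dvd_sub h2 h1)
    rw [show Nat.card F ^ n + 1 - (Nat.card F ^ n - 1) = 2 by have := hcard n; omega] at h3
    exact hp2 ((Nat.prime_dvd_prime_iff_eq hp Nat.prime_two).1 h3)
  obtain ⟨n, rfl⟩ := hm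
  have h1 : p ^ a ∣ Nat.card F ^ (n + n) - 1 := by
    refine ((add_inv_pow_card_pow_eq_iff hζ hN _).1
      ((pow_card_pow_eq_iff_natDegree_minpoly_dvd hint _).2 hd.dvd)).resolve_right fun h => ?_
    exact hnot _ ⟨hpm, (dvd_pow_self p ha).trans h⟩
  have h2 : p ^ a ∣ Nat.card F ^ n - 1 ∨ p ^ a ∣ Nat.card F ^ n + 1 := by
    have hfac : Nat.card F ^ (n + n) - 1 = (Nat.card F ^ n - 1) * (Nat.card F ^ n + 1) := by
      rw [mul_comm, ← Nat.sq_sub_sq, one_pow, ← two_mul, mul_comm, pow_mul]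
    rw [hfac] at h1
    by_cases h : p ∣ Nat.card F ^ n - 1
    · exact Or.inl (Nat.Coprime.dvd_of_dvd_mul_right
        (((hp.coprime_iff_not_dvd).2 fun h' => hnot n ⟨h, h'⟩).pow_left a) h1)
    · exact Or.inr (Nat.Coprime.dvd_of_dvd_mul_left
        (((hp.coprime_iff_not_dvd).2 h).pow_left a) h1)
  have h3 := (pow_card_pow_eq_iff_natDegree_minpoly_dvd hint n).1
    ((add_inv_pow_card_pow_eq_iff hζ hN n).2 h2)
  have := Nat.le_of_dvd (by omega) h3
  omega

open IntermediateField in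
theorem exists_symplectic_of_natDegree_minpoly_lt {L : Type*} [Field L] [Algebra F L] {ζ : L}
    {m : ℕ} (hζ : ζ ≠ 0) (hint : IsIntegral F (ζ + ζ⁻¹))
    (hd : (minpoly F (ζ + ζ⁻¹)).natDegree < m) :
    ∃ u : symplecticGroup (Fin m) F, (∀ n, u ^ n = 1 → ζ ^ n = 1) ∧
      ∃ x y, (u ^ 2).1 *ᵥ x = x ∧ (u ^ 2).1 *ᵥ y = y ∧ symplecticForm (Fin m) F x y ≠ 0 := by
  set t := ζ + ζ⁻¹ with ht
  set d := (minpoly F t).natDegree with hd'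
  have := adjoin.finiteDimensional hint
  have hrank : Module.finrank F (F⟮t⟯ × (Fin (m - d) → F)) = m := by
    rw [Module.finrank_prod, adjoin.finrank hint, Module.finrank_fin_fun]
    omega
  obtain ⟨ψ, hψ⟩ : ∃ ψ : Module.Dual F F⟮t⟯, ψ 1 ≠ 0 := by
    by_contra! h
    exact one_ne_zero ((Module.forall_dual_apply_eq_zero_iff F (1 : F⟮t⟯)).1 h)
  let τ : F⟮t⟯ × (Fin (m - d) → F) →ₗ[F] F := ψ.coprod (∑ i, LinearMap.proj i)
  have hτ : ∀ r, τ r = ψ r.1 + ∑ i, r.2 i := fun r => by simp [τ]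
  let o : Fin (m - d) := ⟨0, by omega⟩
  refine exists_symplectic_of_frobenius_form (Module.finBasisOfFinrankEq F _ hrank) τ ?_
    (AdjoinSimple.gen F t, 0) (0, Pi.single o 1) ?_ ?_
    (F⟮t⟯.val.comp (AlgHom.fst F F⟮t⟯ (Fin (m - d) → F))) ζ hζ ?_
  · rintro ⟨k, z⟩ h
    have hk : k = 0 := by
      by_contra hk
      have h1 := h (k⁻¹, 0)
      rw [hτ] at h1
      apply hψ
      simpa [hk] using h1
    have hz : z = 0 := by
      ext i
      have h1 := h (0, Pi.single i 1)
      rw [hτ] at h1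
      simpa [Pi.single_apply] using h1
    rw [hk, hz]
    rfl
  · simp
  · rw [hτ]
    simp [Pi.single_apply]
  · simp [ht]

theorem exists_mem_formStabilizer_dvd_orderOf_of_odd {m p a : ℕ} (hp : p.Prime) (hp2 : p ≠ 2)
    (hm : Even m) {g : symplecticGroup (Fin m) F} (hg : orderOf g = p ^ (a + 1))
    {v : Fin m ⊕ Fin m → F} (hv : splitForm v ∉ (artinSchreier F).range) :
    ∃ h ∈ formStabilizer v, p ^ (a + 1) ∣ orderOf h := by
  have : Fact p.Prime := ⟨hp⟩
  have hconj : ∀ (h k : symplecticGroup (Fin m) F), orderOf (k * h * k⁻¹) = orderOf h :=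
    fun h k => MulEquiv.orderOf_eq (MulAut.conj k) h
  by_cases hpm : p ∣ Nat.card F ^ m - 1
  swap
  · obtain ⟨k, hk⟩ := exists_conj_mem_of_not_dvd hp2 (by rwa [Fintype.card_fin])
      (hg ▸ pow_orderOf_eq_one g) hv
    exact ⟨_, hk, by rw [hconj, hg]⟩
  obtain ⟨ζ, hζ, hunit⟩ := exists_isPrimitiveRoot_of_orderOf (L := AlgebraicClosure F) hp hp2 g hg
  have hint : IsIntegral F (ζ + ζ⁻¹) := Algebra.IsIntegral.isIntegral _
  have hζ0 : ζ ≠ 0 := hζ.ne_zero (pow_ne_zero _ hp.ne_zero)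
  have hd := natDegree_le_card_of_not_isUnit_aeval g (minpoly.irreducible hint) hunit
  rw [Fintype.card_fin] at hd
  have hm0 : m ≠ 0 := by
    rintro rfl
    have := minpoly.natDegree_pos hint
    omega
  obtain ⟨u, hu, x, y, hx, hy, hxy⟩ := exists_symplectic_of_natDegree_minpoly_lt hζ0 hint
    (lt_of_le_of_ne hd (natDegree_minpoly_add_inv_ne hp hp2 hζ hint hm hm0 a.succ_ne_zero hpm))
  have hdvd : p ^ (a + 1) ∣ orderOf u :=
    hζ.dvd_of_pow_eq_one _ (hu _ (pow_orderOf_eq_one u))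
  set h := u ^ (orderOf u / p ^ (a + 1)) with hh
  have hord : orderOf h = p ^ (a + 1) := orderOf_pow_orderOf_div (orderOf_pos u).ne' hdvd
  have hord2 : orderOf (h ^ 2) = p ^ (a + 1) := by
    rw [Nat.Coprime.orderOf_pow, hord]
    rw [hord]
    exact ((Nat.coprime_primes hp Nat.prime_two).2 hp2).pow_left _
  have hfix : ∀ z, (u ^ 2).1 *ᵥ z = z → (h ^ 2).1 *ᵥ z = z := by
    intro z hz
    rw [hh, ← pow_mul, mul_comm, pow_mul]
    generalize orderOf u / p ^ (a + 1) = k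
    induction k with
    | zero => simp
    | succ k ih =>
      rw [pow_succ, Submonoid.coe_mul, ← Matrix.mulVec_mulVec, hz, ih]
  obtain ⟨w, hw⟩ := exists_mem_formStabilizer hp2 (hord2 ▸ pow_orderOf_eq_one (h ^ 2))
  obtain ⟨k, hk⟩ := exists_conj_mem_of_hyperbolic_pair hw (hfix x hx) (hfix y hy) hxy hv
  exact ⟨_, hk, by rw [hconj, hord2]⟩

end OddElements

section Main

variable {F : Type*} [Field F] [Finite F] [CharP F 2]

theorem exists_mem_formStabilizer_dvd_orderOf_of_two {m a : ℕ} (hm : Even m) (hm4 : 4 ≤ m)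
    {g : symplecticGroup (Fin m) F} (hg : orderOf g = 2 ^ (a + 1))
    {v : Fin m ⊕ Fin m → F} (hv : splitForm v ∉ (artinSchreier F).range) :
    ∃ h ∈ formStabilizer v, 2 ^ (a + 1) ∣ orderOf h := by
  obtain ⟨b, hab, hb⟩ : ∃ b, a ≤ b + 1 ∧ 2 ^ b + 1 < m := by
    rcases a with _ | a
    · exact ⟨0, by omega, by omega⟩
    · refine ⟨a, le_rfl, ?_⟩
      have hlt : 2 ^ (a + 1) < Fintype.card (Fin m ⊕ Fin m) := by
        by_contra! hle
        have h1 : g.1 ^ 2 ^ (a + 1 + 1) = 1 := by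
          rw [← SubmonoidClass.coe_pow, ← hg, pow_orderOf_eq_one]
          rfl
        have h2 : g ^ 2 ^ (a + 1) = 1 := by
          apply Subtype.ext
          rw [SubmonoidClass.coe_pow]
          exact pow_two_pow_eq_one_of_card_le h1 hle
        have h3 := Nat.le_of_dvd (by positivity) (orderOf_dvd_of_pow_eq_one h2)
        rw [hg] at h3
        exact absurd h3 (Nat.pow_lt_pow_right one_lt_two (Nat.lt_succ_self _)).not_ge
      rw [Fintype.card_sum, Fintype.card_fin, pow_succ] at hlt
      rcases a with _ | a
      · omega
      · rw [pow_succ] at hlt ⊢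
        obtain ⟨n, rfl⟩ := hm
        omega
  obtain ⟨u, ⟨t, ht⟩, hu, w, x, y, hw, hx, hy, hxy⟩ := exists_two_element (F := F) hb
  obtain ⟨k, hk⟩ := exists_conj_mem_of_hyperbolic_pair hw hx hy hxy hv
  refine ⟨_, hk, ?_⟩
  rw [show orderOf (k * u * k⁻¹) = orderOf u from MulEquiv.orderOf_eq (MulAut.conj k) u]
  obtain ⟨s, -, hs⟩ := (Nat.dvd_prime_pow Nat.prime_two).1 (orderOf_dvd_of_pow_eq_one ht)
  rw [hs]
  apply pow_dvd_pow
  by_contra! hlt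
  apply hu
  rw [← orderOf_dvd_iff_pow_eq_one, hs]
  exact pow_dvd_pow _ (by omega)

theorem exponent_formStabilizer {m : ℕ} (hm : Even m) (hm4 : 4 ≤ m)
    {v : Fin m ⊕ Fin m → F} (hv : splitForm v ∉ (artinSchreier F).range) :
    Monoid.exponent (formStabilizer v) = Monoid.exponent (symplecticGroup (Fin m) F) := by
  apply Nat.dvd_antisymm
  · exact Monoid.exponent_dvd_of_monoidHom _ (formStabilizer v).subtype_injective
  rw [Monoid.exponent_dvd]
  intro g
  rw [Nat.dvd_iff_prime_pow_dvd_dvd]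
  intro p k hp hpk
  rcases k with _ | a
  · simp
  have hord := orderOf_pow_orderOf_div (orderOf_pos g).ne' hpk
  obtain ⟨h, hh, hdvd⟩ : ∃ h ∈ formStabilizer v, p ^ (a + 1) ∣ orderOf h := by
    rcases eq_or_ne p 2 with rfl | hp2
    · exact exists_mem_formStabilizer_dvd_orderOf_of_two hm hm4 hord hv
    · exact exists_mem_formStabilizer_dvd_orderOf_of_odd hp hp2 hm hord hv
  refine hdvd.trans ?_
  rw [← Subgroup.orderOf_mk h hh]
  exact Monoid.order_dvd_exponent _

theorem exists_formStabilizer_ne_top {m : ℕ} (hm : 2 ≤ m) :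
    ∃ v : Fin m ⊕ Fin m → F,
      splitForm v ∉ (artinSchreier F).range ∧ formStabilizer v ≠ ⊤ := by
  obtain ⟨c, hc⟩ : ∃ c, c ∉ (artinSchreier F).range := by
    by_contra! h
    have := index_range_artinSchreier F
    rw [(AddSubgroup.eq_top_iff' _).2 h, AddSubgroup.index_top] at this
    omega
  have hsplit : ∀ i : Fin m, splitForm (Sum.elim (Pi.single i 1) (Pi.single i c)) = c := by
    intro i
    simp [splitForm, Pi.single_apply]
  refine ⟨_, (hsplit ⟨0, by omega⟩).symm ▸ hc,
    formStabilizer_ne_top (w := Sum.elim (Pi.single ⟨1, hm⟩ 1) (Pi.single ⟨1, hm⟩ c)) ?_ ?_⟩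
  · intro h
    have h0 := congrFun h (Sum.inl ⟨0, by omega⟩)
    simp at h0
  · rw [hsplit, hsplit]

end Main

end SymplecticEvenChar

/-- Let `q = 2^k` and `m ≥ 4` even. Then the symplectic group `Sp_{2m}(F_q)` contains
a proper subgroup with the same exponent. -/
theorem symplecticGroup_even_char_exists_proper_subgroup_same_exponent
    (k q : ℕ) (hk : 1 ≤ k) (hq : q = 2 ^ k)
    (F : Type) [Field F] [Fintype F] (hF : Fintype.card F = q)
    (m : ℕ) (hm : 4 ≤ m) (hme : Even m) :
    ∃ H : Subgroup (Matrix.symplecticGroup (Fin m) F), H ≠ ⊤ ∧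
      Monoid.exponent H = Monoid.exponent (Matrix.symplecticGroup (Fin m) F) := by
  have : CharP F 2 := charP_of_card_eq_prime_pow (hF.trans hq)
  obtain ⟨v, hv, htop⟩ :=
    SymplecticEvenChar.exists_formStabilizer_ne_top (F := F) (m := m) (by omega)
  exact ⟨_, htop, SymplecticEvenChar.exponent_formStabilizer hme hm hv⟩
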